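/- Let x be a positive integer with standard base-3 representation x_k…x_0 (most significant digit first, x_k ≠ 0). The Turing machine M1, started from the configuration ωb (A x_k) x_{k−1} … x_0 bω, eventually reaches a configuration of the form ωb 0^n (A 1) bω for some n ≥ 0 if and only if there exists m ≥ 0 with T^m(x) = 1. -/

import Mathlib

namespace Collatz

/-- The 3x+1 function. -/
def T (x : ℕ) : ℕ := if x % 2 = 0 then x / 2 else (3 * x + 1) / 2

/-- The 3x+1 conjecture: iterating `T` from any positive integer
eventually reaches the loop `2 ↦ 1 ↦ 2`. -/
def CollatzConjecture : Prop :=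
  ∀ x : ℕ, 0 < x → ∃ k : ℕ, T^[k] x = 2 ∧ T^[k + 1] x = 1

inductive St | A | B | C
  deriving DecidableEq

inductive Sym | blank | d0 | d1 | d2
  deriving DecidableEq

open St Sym

/-- Transition table of the Turing machine `M1`
(`true` = move right, `false` = move left). -/
def delta : St → Sym → Option (Sym × Bool × St)
  | A, blank => some (blank, false, C)
  | A, d0    => some (d0, true, A)
  | A, d1    => some (d0, true, B)
  | A, d2    => some (d1, true, A)
  | B, blank => some (d2, false, C)
  | B, d0    => some (d1, true, B)
  | B, d1    => some (d2, true, A)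
  | B, d2    => some (d2, true, B)
  | C, blank => some (blank, true, A)
  | C, d0    => some (d0, false, C)
  | C, d1    => some (d1, false, C)
  | C, d2    => some (d2, false, C)

structure Cfg where
  state : St
  head : ℤ
  tape : ℤ → Sym

/-- One step of the machine; `none` when the transition is undefined
(in particular in the halting state, which has no transitions).
In `delta`, the `Bool` component is the direction: `true` = right, `false` = left. -/
def step (c : Cfg) : Option Cfg :=
  (delta c.state (c.tape c.head)).map fun t =>
    ⟨t.2.2, c.head + (if t.2.1 then 1 else -1), Function.update c.tape c.head t.1⟩

/-- `steps n c` is the configuration after `n` steps from `c`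
(`none` if the machine has halted meanwhile). -/
def steps : ℕ → Cfg → Option Cfg
  | 0, c => some c
  | n + 1, c => (step c).bind (steps n)

/-- The tape holding the word `w` at positions `0, …, w.length - 1`,
and the blank symbol everywhere else. -/
def tapeOf (w : List Sym) : ℤ → Sym :=
  fun i => if 0 ≤ i then w.getD i.toNat blank else blank

/-- `c` is the configuration `ωb u (q s) v bω`, where `w = u ++ s :: v` and
`pos = u.length` (i.e. the tape holds exactly the word `w` surrounded by blanks,
the machine is in state `q`, and the head scans the symbol of `w` at index `pos`). -/
def IsConfig (c : Cfg) (q : St) (w : List Sym) (pos : ℕ) : Prop :=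
  c.state = q ∧ ∃ d : ℤ, c.head = d + pos ∧ c.tape = fun i => tapeOf w (i - d)

/-- The machine eventually reaches the configuration `ωb u (q s) v bω`. -/
def Reaches (c : Cfg) (q : St) (w : List Sym) (pos : ℕ) : Prop :=
  ∃ t : ℕ, ∃ c' : Cfg, steps t c = some c' ∧ IsConfig c' q w pos

/-- The machine halts when started from configuration `c`. -/
def Halts (c : Cfg) : Prop := ∃ n : ℕ, steps n c = none

/-- Initial configuration: word `w` on the tape, head on its leftmost symbol, state `A`. -/
def initCfg (w : List Sym) : Cfg := ⟨St.A, 0, tapeOf w⟩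

/-- The symbol encoding a base-3 digit. -/
def symOfDigit (n : ℕ) : Sym := if n = 0 then d0 else if n = 1 then d1 else d2

/-- The standard base-3 representation of `x`, most significant digit first. -/
def base3Word (x : ℕ) : List Sym := ((Nat.digits 3 x).reverse).map symOfDigit

/-- Symbol of a ternary digit. -/
def sy (a : Fin 3) : Sym := symOfDigit a.val

/-- Tape split at `p`: `R` written from `p` rightwards, `L` from `p-1` leftwards. -/
def Zt (p : ℤ) (L R : List (Fin 3)) : ℤ → Sym := fun i =>
  if p ≤ i then (R.map sy).getD (i - p).toNat blank
  else (L.map sy).getD (p - 1 - i).toNat blank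

/-- Value of a list, least significant digit first. -/
def rv : List (Fin 3) → ℕ
  | [] => 0
  | a :: l => a.val + 3 * rv l

/-- Value of a list, most significant digit first, with accumulator. -/
def fv : ℕ → List (Fin 3) → ℕ
  | acc, [] => acc
  | acc, a :: l => fv (3 * acc + a.val) l

lemma Zt_head (p : ℤ) (L R : List (Fin 3)) (a : Fin 3) : Zt p L (a :: R) p = sy a := by
  simp [Zt]

lemma Zt_head_nil (p : ℤ) (L : List (Fin 3)) : Zt p L [] p = blank := by
  simp [Zt]

lemma Zt_left (p : ℤ) (L R : List (Fin 3)) (a : Fin 3) : Zt p (a :: L) R (p - 1) = sy a := by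
  simp [Zt]

lemma Zt_left_nil (p : ℤ) (R : List (Fin 3)) : Zt p [] R (p - 1) = blank := by
  simp [Zt]

lemma Zt_shift (p : ℤ) (L R : List (Fin 3)) (a : Fin 3) :
    Zt (p + 1) (a :: L) R = Zt p L (a :: R) := by
  funext i
  unfold Zt
  rcases lt_trichotomy i p with h | h | h
  · have h1 : ¬ (p + 1 ≤ i) := by omega
    have h2 : ¬ (p ≤ i) := by omega
    have h3 : (p + 1 - 1 - i).toNat = (p - 1 - i).toNat + 1 := by omega
    rw [if_neg h1, if_neg h2, h3]; simp
  · subst h; simp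
  · have h1 : (p + 1 ≤ i) := by omega
    have h2 : (p ≤ i) := by omega
    have h3 : (i - p).toNat = (i - (p + 1)).toNat + 1 := by omega
    rw [if_pos h1, if_pos h2, h3]; simp

lemma Zt_update (p : ℤ) (L R : List (Fin 3)) (a b : Fin 3) :
    Function.update (Zt p L (a :: R)) p (sy b) = Zt p L (b :: R) := by
  funext i
  by_cases h : i = p
  · subst h; simp [Zt_head]
  · rw [Function.update_of_ne h]
    unfold Zt
    by_cases h2 : p ≤ i
    · have h3 : (i - p).toNat = (i - p - 1).toNat + 1 := by omega
      rw [if_pos h2, if_pos h2, h3]; simp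
    · rw [if_neg h2, if_neg h2]

lemma Zt_update_nil (p : ℤ) (L : List (Fin 3)) (b : Fin 3) :
    Function.update (Zt p L []) p (sy b) = Zt p L [b] := by
  funext i
  by_cases h : i = p
  · subst h; simp [Zt_head]
  · rw [Function.update_of_ne h]
    unfold Zt
    by_cases h2 : p ≤ i
    · have h3 : (i - p).toNat = (i - p - 1).toNat + 1 := by omega
      rw [if_pos h2, if_pos h2, h3]; simp
    · rw [if_neg h2, if_neg h2]

lemma sy_ne (a : Fin 3) : sy a ≠ blank := by
  fin_cases a <;> decide

lemma sy_inj {a b : Fin 3} (h : sy a = sy b) : a = b := by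
  revert h; revert a b; decide

lemma getD_inj : ∀ (L L' : List (Fin 3)),
    (∀ i : ℕ, (L.map sy).getD i blank = (L'.map sy).getD i blank) → L = L'
  | [], [], _ => rfl
  | [], b :: l', h => absurd (by simpa using (h 0).symm) (sy_ne b)
  | a :: l, [], h => absurd (by simpa using h 0) (sy_ne a)
  | a :: l, b :: l', h => by
    have h0 : a = b := sy_inj (by simpa using h 0)
    have h1 : l = l' := getD_inj l l' (fun i => by simpa using h (i + 1))
    rw [h0, h1]

lemma Zt_inj {p : ℤ} {L R L' R' : List (Fin 3)} (h : Zt p L R = Zt p L' R') :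
    L = L' ∧ R = R' := by
  constructor
  · apply getD_inj
    intro i
    have := congrFun h (p - 1 - i)
    unfold Zt at this
    have h2 : ¬ (p ≤ p - 1 - (i : ℤ)) := by omega
    have h3 : (p - 1 - (p - 1 - (i : ℤ))).toNat = i := by omega
    rwa [if_neg h2, if_neg h2, h3] at this
  · apply getD_inj
    intro i
    have := congrFun h (p + i)
    unfold Zt at this
    have h2 : (p ≤ p + (i : ℤ)) := by omega
    have h3 : (p + (i : ℤ) - p).toNat = i := by omega
    rwa [if_pos h2, if_pos h2, h3] at this

lemma tapeOf_eq (d : ℤ) : ∀ (L R : List (Fin 3)),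
    (fun i => tapeOf ((L.reverse ++ R).map sy) (i - d)) = Zt (d + L.length) L R
  | [], R => by
    funext i
    simp [tapeOf, Zt]
  | a :: L, R => by
    have := tapeOf_eq d L (a :: R)
    have e : d + ((a :: L).length : ℤ) = (d + L.length) + 1 := by
      simp; ring
    rw [e, Zt_shift, ← this]
    simp

lemma word_target (n : ℕ) :
    List.replicate n d0 ++ [d1] =
      (((List.replicate n (0 : Fin 3)).reverse ++ [1]).map sy) := by
  simp [sy, symOfDigit]

lemma isConfig_iff (c : Cfg) (n : ℕ) :
    IsConfig c A (List.replicate n d0 ++ [d1]) n ↔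
      ∃ p : ℤ, c = ⟨A, p, Zt p (List.replicate n 0) [1]⟩ := by
  rw [word_target]
  unfold IsConfig
  obtain ⟨q, h, t⟩ := c
  constructor
  · rintro ⟨h1, d, h2, h3⟩
    refine ⟨d + n, ?_⟩
    have := tapeOf_eq d (List.replicate n 0) [1]
    rw [this] at h3
    simp only [List.length_replicate] at h3
    simp only at h1 h2
    rw [h1, h2, h3]
  · rintro ⟨p, hp⟩
    have := tapeOf_eq (p - n) (List.replicate n 0) [1]
    simp only [Cfg.mk.injEq] at hp
    obtain ⟨h1, h2, h3⟩ := hp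
    refine ⟨h1, p - n, by simp [h2], ?_⟩
    rw [this]
    simp [h3]

/-- Reachability. -/
def Rch (c c' : Cfg) : Prop := ∃ t, steps t c = some c'

lemma Rch.refl (c : Cfg) : Rch c c := ⟨0, rfl⟩

lemma Rch.head {c c' c'' : Cfg} (h : step c = some c') (h2 : Rch c' c'') : Rch c c'' := by
  obtain ⟨t, ht⟩ := h2
  exact ⟨t + 1, by simp [steps, h, ht]⟩

lemma Rch.trans {c c' c'' : Cfg} (h : Rch c c') (h2 : Rch c' c'') : Rch c c'' := by
  obtain ⟨t, ht⟩ := h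
  induction t generalizing c with
  | zero => simp only [steps, Option.some.injEq] at ht; subst ht; exact h2
  | succ t ih =>
    simp only [steps, Option.bind_eq_some_iff] at ht
    obtain ⟨d, hd, hd2⟩ := ht
    exact Rch.head hd (ih hd2)

/-- Carry state. -/
def cs (r : Bool) : St := if r then B else A

lemma step_sweep (r : Bool) (a : Fin 3) : ∃ (e : Fin 3) (r' : Bool),
    2 * e.val + r'.toNat = 3 * r.toNat + a.val ∧
    ∀ (p : ℤ) (L R : List (Fin 3)), step ⟨cs r, p, Zt p L (a :: R)⟩ =
      some ⟨cs r', p + 1, Zt (p + 1) (e :: L) R⟩ := by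
  have key : ∃ (e : Fin 3) (r' : Bool), 2 * e.val + r'.toNat = 3 * r.toNat + a.val ∧
      delta (cs r) (sy a) = some (sy e, true, cs r') := by
    revert r a; decide
  obtain ⟨e, r', h1, h2⟩ := key
  refine ⟨e, r', h1, fun p L R => ?_⟩
  simp only [step, Zt_head, h2, Option.map_some, Zt_update, Zt_shift, if_true]

lemma step_endA (p : ℤ) (L : List (Fin 3)) :
    step ⟨cs false, p, Zt p L []⟩ = some ⟨C, p - 1, Zt p L []⟩ := by
  have : Function.update (Zt p L []) p blank = Zt p L [] := by
    rw [Function.update_eq_self_iff, Zt_head_nil]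
  simp [step, Zt_head_nil, cs, delta, this, sub_eq_add_neg]

lemma step_endB (p : ℤ) (L : List (Fin 3)) :
    step ⟨cs true, p, Zt p L []⟩ = some ⟨C, p - 1, Zt p L [2]⟩ := by
  have : Function.update (Zt p L []) p d2 = Zt p L [2] := Zt_update_nil p L 2
  simp [step, Zt_head_nil, cs, delta, this, sub_eq_add_neg]

lemma step_C (p : ℤ) (L R : List (Fin 3)) (a : Fin 3) :
    step ⟨C, p - 1, Zt p (a :: L) R⟩ = some ⟨C, (p - 1) - 1, Zt (p - 1) L (a :: R)⟩ := by
  have e : delta C (sy a) = some (sy a, false, C) := by revert a; decide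
  have h : Zt p (a :: L) R = Zt (p - 1) L (a :: R) := by
    rw [← Zt_shift]; simp
  simp only [step, h, Zt_head, e, Option.map_some, Zt_update]
  simp [sub_eq_add_neg]

lemma step_Cend (p : ℤ) (R : List (Fin 3)) :
    step ⟨C, p - 1, Zt p [] R⟩ = some ⟨cs false, p, Zt p [] R⟩ := by
  have : Function.update (Zt p [] R) (p - 1) blank = Zt p [] R := by
    rw [Function.update_eq_self_iff, Zt_left_nil]
  simp [step, Zt_left_nil, cs, delta, this]

lemma T_even (n : ℕ) : T (2 * n) = n := by
  unfold T; rw [if_pos (by omega)]; omega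

lemma T_odd (n : ℕ) : T (2 * n + 1) = 3 * n + 2 := by
  unfold T; rw [if_neg (by omega)]; omega

/-- The invariant: the configuration encodes the number `y`. -/
inductive Inv (y : ℕ) : Cfg → Prop
  | sweep (r : Bool) (p : ℤ) (L R : List (Fin 3)) (h : fv (2 * rv L + r.toNat) R = y) :
      Inv y ⟨cs r, p, Zt p L R⟩
  | back (p : ℤ) (L R : List (Fin 3)) (h : fv (rv L) R = y) : Inv y ⟨C, p - 1, Zt p L R⟩

lemma Inv.step {y : ℕ} {c c' : Cfg} (h : Inv y c) (hs : step c = some c') :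
    Inv y c' ∨ Inv (T y) c' := by
  cases h with
  | sweep r p L R h =>
    cases R with
    | nil =>
      right
      cases r with
      | false =>
        rw [step_endA] at hs; cases hs
        refine Inv.back p L [] ?_
        rw [← h]; simp [fv, T_even]
      | true =>
        rw [step_endB] at hs; cases hs
        refine Inv.back p L [2] ?_
        rw [← h]; simp [fv, T_odd]
    | cons a R =>
      left
      obtain ⟨e, r', h1, h2⟩ := step_sweep r a
      rw [h2] at hs; cases hs
      refine Inv.sweep r' (p + 1) (e :: L) R ?_
      rw [← h]
      simp only [fv, rv]
      congr 1; omega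
  | back p L R h =>
    left
    cases L with
    | nil =>
      rw [step_Cend] at hs; cases hs
      exact Inv.sweep false p [] R (by rw [← h]; simp [rv])
    | cons a L =>
      rw [step_C] at hs; cases hs
      refine Inv.back (p - 1) L (a :: R) ?_
      rw [← h]; simp only [fv, rv]; congr 1; omega

lemma Inv.rch {x : ℕ} (t : ℕ) : ∀ {m : ℕ} {c c' : Cfg}, Inv (T^[m] x) c →
    steps t c = some c' → ∃ m', Inv (T^[m'] x) c' := by
  induction t with
  | zero => intro m c c' h hs; simp only [steps, Option.some.injEq] at hs; subst hs; exact ⟨m, h⟩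
  | succ t ih =>
    intro m c c' h hs
    simp only [steps, Option.bind_eq_some_iff] at hs
    obtain ⟨d, hd, hd2⟩ := hs
    rcases h.step hd with h | h
    · exact ih h hd2
    · rw [← Function.iterate_succ_apply' T] at h
      exact ih h hd2

lemma rv_zeros (n : ℕ) : rv (List.replicate n 0) = 0 := by
  induction n with
  | zero => rfl
  | succ n ih => simp [List.replicate_succ, rv, ih]

lemma Inv.target {y n : ℕ} {p : ℤ}
    (h : Inv y ⟨A, p, Zt p (List.replicate n 0) [1]⟩) : y = 1 := by
  generalize hc : (⟨A, p, Zt p (List.replicate n 0) [1]⟩ : Cfg) = c at h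
  cases h with
  | sweep r p' L R h =>
    simp only [Cfg.mk.injEq] at hc
    obtain ⟨h1, h2, h3⟩ := hc
    subst h2
    obtain ⟨h4, h5⟩ := Zt_inj h3
    subst h4 h5
    cases r with
    | false => rw [← h]; simp [fv, rv_zeros]
    | true => simp [cs] at h1
  | back p' L R h => simp at hc

lemma rch_back : ∀ (L R : List (Fin 3)) (p : ℤ), ∃ (p' : ℤ) (R' : List (Fin 3)),
    fv 0 R' = fv (rv L) R ∧ Rch ⟨C, p - 1, Zt p L R⟩ ⟨cs false, p', Zt p' [] R'⟩
  | [], R, p => ⟨p, R, rfl, Rch.head (step_Cend p R) (Rch.refl _)⟩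
  | a :: L, R, p => by
    obtain ⟨p', R', h1, h2⟩ := rch_back L (a :: R) (p - 1)
    refine ⟨p', R', ?_, Rch.head (step_C p L R a) h2⟩
    rw [h1]; simp only [fv, rv]; congr 1; omega

lemma rch_sweep : ∀ (R L : List (Fin 3)) (r : Bool) (p : ℤ),
    ∃ (p' : ℤ) (R' : List (Fin 3)), fv 0 R' = T (fv (2 * rv L + r.toNat) R) ∧
      Rch ⟨cs r, p, Zt p L R⟩ ⟨cs false, p', Zt p' [] R'⟩
  | [], L, false, p => by
    obtain ⟨p', R', h1, h2⟩ := rch_back L [] p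
    refine ⟨p', R', ?_, Rch.head (step_endA p L) h2⟩
    rw [h1]; simp [fv, T_even]
  | [], L, true, p => by
    obtain ⟨p', R', h1, h2⟩ := rch_back L [2] p
    refine ⟨p', R', ?_, Rch.head (step_endB p L) h2⟩
    rw [h1]; simp [fv, T_odd]
  | a :: R, L, r, p => by
    obtain ⟨e, r', h1, h2⟩ := step_sweep r a
    obtain ⟨p', R', h3, h4⟩ := rch_sweep R (e :: L) r' (p + 1)
    refine ⟨p', R', ?_, Rch.head (h2 p L R) h4⟩
    rw [h3]; simp only [fv, rv]; congr 2; omega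

lemma rch_iter (m : ℕ) (p : ℤ) (R : List (Fin 3)) : ∃ (p' : ℤ) (R' : List (Fin 3)),
    fv 0 R' = T^[m] (fv 0 R) ∧ Rch ⟨A, p, Zt p [] R⟩ ⟨A, p', Zt p' [] R'⟩ := by
  induction m with
  | zero => exact ⟨p, R, rfl, Rch.refl _⟩
  | succ m ih =>
    obtain ⟨p1, R1, h1, h2⟩ := ih
    obtain ⟨p2, R2, h3, h4⟩ := rch_sweep R1 [] false p1
    refine ⟨p2, R2, ?_, h2.trans h4⟩
    rw [h3, Function.iterate_succ_apply', ← h1]; simp [rv]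

lemma fv_ge : ∀ (R : List (Fin 3)) (k : ℕ), k ≤ fv k R
  | [], _ => le_rfl
  | a :: R, k => by
    have := fv_ge R (3 * k + a.val)
    simp only [fv]; omega

lemma rch_one : ∀ (R : List (Fin 3)) (n : ℕ) (p : ℤ), fv 0 R = 1 →
    ∃ (n' : ℕ) (p' : ℤ), Rch ⟨A, p, Zt p (List.replicate n 0) R⟩
      ⟨A, p', Zt p' (List.replicate n' 0) [1]⟩
  | [], n, p, h => by simp [fv] at h
  | a :: R, n, p, h => by
    simp only [fv] at h
    have ha := fv_ge R (3 * 0 + a.val)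
    have ha2 : a = 0 ∨ a = 1 := by
      have : a.val ≤ 1 := by omega
      revert this; clear h ha; revert a; decide
    rcases ha2 with rfl | rfl
    · obtain ⟨n', p', h'⟩ := rch_one R (n + 1) (p + 1) (by simpa using h)
      refine ⟨n', p', Rch.head ?_ h'⟩
      rw [List.replicate_succ, Zt_shift]
      have e : Function.update (Zt p (List.replicate n 0) (0 :: R)) p d0
        = Zt p (List.replicate n 0) (0 :: R) := Zt_update _ _ _ 0 0
      have e2 : sy 0 = d0 := rfl
      simp [step, Zt_head, e2, delta, e]
    · cases R with
      | nil => exact ⟨n, p, Rch.refl _⟩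
      | cons b R =>
        simp only [fv] at h
        have := fv_ge R (3 * (3 * 0 + (1 : Fin 3).val) + b.val)
        have h1 : (1 : Fin 3).val = 1 := rfl
        omega

lemma fv_snoc (a : Fin 3) : ∀ (R : List (Fin 3)) (k : ℕ),
    fv k (R ++ [a]) = 3 * fv k R + a.val
  | [], _ => rfl
  | b :: R, k => fv_snoc a R (3 * k + b.val)

lemma fv_reverse : ∀ (l : List ℕ), (∀ d ∈ l, d < 3) →
    fv 0 ((l.map (Fin.ofNat 3)).reverse) = Nat.ofDigits 3 l
  | [], _ => rfl
  | a :: l, h => by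
    have ih := fv_reverse l (fun d hd => h d (by simp [hd]))
    have ha : a % 3 = a := Nat.mod_eq_of_lt (h a (by simp))
    simp only [List.map_cons, List.reverse_cons, fv_snoc, ih, Nat.ofDigits_cons,
      Fin.ofNat, ha]
    push_cast
    ring

lemma init_eq (x : ℕ) : ∃ R : List (Fin 3), fv 0 R = x ∧
    initCfg (base3Word x) = ⟨A, 0, Zt 0 [] R⟩ := by
  have hd : ∀ d ∈ Nat.digits 3 x, d < 3 := fun d hd => Nat.digits_lt_base (by norm_num) hd
  refine ⟨((Nat.digits 3 x).map (Fin.ofNat 3)).reverse, ?_, ?_⟩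
  · rw [fv_reverse _ hd, Nat.ofDigits_digits]
  · have h := tapeOf_eq 0 [] (((Nat.digits 3 x).map (Fin.ofNat 3)).reverse)
    have e : base3Word x = (((Nat.digits 3 x).map (Fin.ofNat 3)).reverse).map sy := by
      unfold base3Word
      rw [← List.map_reverse, List.map_map]
      apply List.map_congr_left
      intro d hd'
      have := hd d (by simpa using hd')
      simp [sy, Fin.ofNat, Nat.mod_eq_of_lt this]
    unfold initCfg
    rw [e]
    simp only [List.reverse_nil, List.nil_append, sub_zero, List.length_nil,
      Nat.cast_zero, add_zero] at h
    rw [← h]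

/-- For a positive integer `x` with standard base-3 representation `x_k … x_0`,
the machine `M1`, started from `ωb (A x_k) x_{k-1} … x_0 bω`, eventually reaches a
configuration `ωb 0^n (A 1) bω` for some `n ≥ 0` iff some iterate of `T` at `x` is `1`. -/
theorem M1_reaches_iff_iterate_one (x : ℕ) (hx : 0 < x) :
    (∃ n : ℕ, Reaches (initCfg (base3Word x)) A (List.replicate n d0 ++ [d1]) n) ↔
      (∃ m : ℕ, T^[m] x = 1) := by
  obtain ⟨R, hR, hinit⟩ := init_eq x
  rw [hinit]
  constructor
  · rintro ⟨n, t, c', hs, hc⟩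
    obtain ⟨p, rfl⟩ := (isConfig_iff c' n).1 hc
    have h0 : Inv (T^[0] x) ⟨A, 0, Zt 0 [] R⟩ :=
      Inv.sweep false 0 [] R (by simpa [rv] using hR)
    obtain ⟨m, hm⟩ := Inv.rch t h0 hs
    exact ⟨m, hm.target⟩
  · rintro ⟨m, hm⟩
    obtain ⟨p, R', h1, h2⟩ := rch_iter m 0 R
    rw [hR, hm] at h1
    obtain ⟨n, p', h3⟩ := rch_one R' 0 p h1
    obtain ⟨t, ht⟩ := h2.trans h3
    exact ⟨n, t, _, ht, (isConfig_iff _ n).2 ⟨p', rfl⟩⟩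

end Collatz
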